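/- Let x ∈ (0,1) be irrational. For every j ≥ 0: 1 < 2·Θ(x, p_j/q_j) + Θ(x, f_j) < 2, where f_j := ((a_{j+1} − 1) p_j + p_{j−1})/((a_{j+1} − 1) q_j + q_{j−1}) (so f_j = p_{j−1}/q_{j−1} when a_{j+1} = 1). Moreover, if a_{j+1} > 1 then for every 0 ≤ λ < a_{j+1} − 1: |Θ(x, m_{j,λ+1}) − Θ(x, m_{j,λ})| < 1, where m_{j,λ} := (λ p_j + p_{j−1})/(λ q_j + q_{j−1}). -/

import Mathlib

open MeasureTheory Filter Topology
open scoped Classical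

noncomputable section

/-- The Farey tent map `F`. -/
def fareyMap (x : ℝ) : ℝ := if x ≤ 1/2 then x / (1 - x) else (1 - x) / x

/-- `eps x n = ε_{n+1}(x)`, i.e. `0` if `F^[n] x ≤ 1/2` and `1` otherwise. -/
def eps (x : ℝ) (n : ℕ) : ℤ := if fareyMap^[n] x ≤ 1/2 then 0 else 1

/-- The matrices `A_0 = [[1,0],[1,1]]` and `A_1 = [[0,1],[1,1]]`. -/
def Amat (e : ℤ) : Matrix (Fin 2) (Fin 2) ℤ := !![1 - e, e; 1, 1]

/-- `Mmat x n = A_{ε_1(x)} ⋯ A_{ε_n(x)}`, with `Mmat x 0` the identity. -/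
def Mmat (x : ℝ) : ℕ → Matrix (Fin 2) (Fin 2) ℤ
  | 0 => 1
  | n + 1 => Mmat x n * Amat (eps x n)

/-- `u_n(x)`: top-left entry of `M_n(x)`. -/
def uF (x : ℝ) (n : ℕ) : ℤ := Mmat x n 0 0

/-- `s_n(x)`: bottom-left entry of `M_n(x)`. -/
def sF (x : ℝ) (n : ℕ) : ℤ := Mmat x n 1 0

/-- Ito's natural extension `F̄` of the Farey tent map. -/
def fareyNE (p : ℝ × ℝ) : ℝ × ℝ :=
  if p.1 ≤ 1/2 then (p.1 / (1 - p.1), p.2 / (1 + p.2))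
  else ((1 - p.1) / p.1, 1 / (1 + p.2))

/-- `Ω = [0,1]²`. -/
def OmegaSet : Set (ℝ × ℝ) := Set.Icc (0:ℝ) 1 ×ˢ Set.Icc (0:ℝ) 1

/-- The measure `μ̄` on `Ω` with density `(x + y − xy)⁻²` w.r.t. Lebesgue measure. -/
def muBar : Measure (ℝ × ℝ) :=
  (volume.restrict OmegaSet).withDensity
    (fun p => ENNReal.ofReal (1 / (p.1 + p.2 - p.1 * p.2) ^ 2))

/-- A proper inducible subregion of `Ω`. -/
def ProperInducible (R : Set (ℝ × ℝ)) : Prop :=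
  R ⊆ OmegaSet ∧ MeasurableSet R ∧ 0 < muBar R ∧ muBar R < ⊤ ∧ muBar (frontier R) = 0

/-- `hitsR R x k` holds iff `k ≥ 1` and `F̄^[k] (x,1) ∈ R`. -/
def hitsR (R : Set (ℝ × ℝ)) (x : ℝ) (k : ℕ) : Prop := 1 ≤ k ∧ fareyNE^[k] (x, 1) ∈ R

/-- `Nidx R x n = N_n`: `N_0 = 0` and, for `n ≥ 1`, the `n`-th smallest `k ≥ 1`
with `F̄^[k] (x,1) ∈ R`. -/
def Nidx (R : Set (ℝ × ℝ)) (x : ℝ) : ℕ → ℕ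
  | 0 => 0
  | n + 1 => Nat.nth (hitsR R x) n

/-- `h(x,y) = (1−y)/(x + y − xy)`. -/
def hIto (p : ℝ × ℝ) : ℝ := (1 - p.2) / (p.1 + p.2 - p.1 * p.2)

/-- `Θ_n(x) = s_n(x)·|s_n(x)·x − u_n(x)|`, the approximation coefficient of the
`n`-th Farey convergent `u_n(x)/s_n(x)`. -/
def ThetaF (x : ℝ) (n : ℕ) : ℝ := (sF x n : ℝ) * |(sF x n : ℝ) * x - (uF x n : ℝ)|

/-- `Θ_n^R(x) = s_n^R·|s_n^R·x − u_n^R|` where `u_n^R = u_{N_n}(x)`, `s_n^R = s_{N_n}(x)`. -/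
def ThetaR (R : Set (ℝ × ℝ)) (x : ℝ) (n : ℕ) : ℝ := ThetaF x (Nidx R x n)

/-- The Gauss map. -/
def gaussMap (x : ℝ) : ℝ := Int.fract (1 / x)

/-- `pquot x n` is the RCF partial quotient `a_{n+1}(x)`. -/
def pquot (x : ℝ) (n : ℕ) : ℤ := ⌊1 / (gaussMap^[n] x)⌋

/-- `pnum x (j+1)` is the RCF numerator `p_j(x)`; `pnum x 0 = p_{-1} = 1`. -/
def pnum (x : ℝ) : ℕ → ℤ
  | 0 => 1
  | 1 => 0
  | n + 2 => pquot x n * pnum x (n + 1) + pnum x n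

/-- `qden x (j+1)` is the RCF denominator `q_j(x)`; `qden x 0 = q_{-1} = 0`. -/
def qden (x : ℝ) : ℕ → ℤ
  | 0 => 0
  | 1 => 1
  | n + 2 => pquot x n * qden x (n + 1) + qden x n

/-- The approximation coefficient `Θ(x, p/q) = q·|q·x − p|`. -/
def Theta (x : ℝ) (p q : ℤ) : ℝ := (q : ℝ) * |(q : ℝ) * x - (p : ℝ)|

/-- `medTheta x l j = Θ(x, (l·p_j + p_{j−1})/(l·q_j + q_{j−1}))`. -/
def medTheta (x : ℝ) (l : ℤ) (j : ℕ) : ℝ :=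
  Theta x (l * pnum x (j + 1) + pnum x j) (l * qden x (j + 1) + qden x j)

end

lemma gaussMap_iterate_mem_Ioo_and_irrational {x : ℝ} (hx : x ∈ Set.Ioo (0 : ℝ) 1)
    (hirr : Irrational x) (n : ℕ) :
    gaussMap^[n] x ∈ Set.Ioo (0 : ℝ) 1 ∧ Irrational (gaussMap^[n] x) := by
  induction n with
  | zero => exact ⟨hx, hirr⟩
  | succ n ih =>
    rw [Function.iterate_succ_apply']
    have h : Irrational (gaussMap (gaussMap^[n] x)) := by
      unfold gaussMap Int.fract
      rw [one_div]
      exact ih.2.inv.sub_intCast _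
    exact ⟨⟨(Int.fract_nonneg _).lt_of_ne' h.ne_zero, Int.fract_lt_one _⟩, h⟩

lemma gaussMap_iterate_succ_mul {x : ℝ} (hx : x ∈ Set.Ioo (0 : ℝ) 1)
    (hirr : Irrational x) (n : ℕ) :
    gaussMap^[n + 1] x * gaussMap^[n] x = 1 - pquot x n * gaussMap^[n] x := by
  have ht := (gaussMap_iterate_mem_Ioo_and_irrational hx hirr n).1.1.ne'
  have h : gaussMap^[n + 1] x = 1 / gaussMap^[n] x - pquot x n := by
    rw [Function.iterate_succ_apply']
    rfl
  rw [h]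
  field_simp

lemma one_le_pquot {x : ℝ} (hx : x ∈ Set.Ioo (0 : ℝ) 1) (hirr : Irrational x) (n : ℕ) :
    1 ≤ pquot x n := by
  obtain ⟨h0, h1⟩ := (gaussMap_iterate_mem_Ioo_and_irrational hx hirr n).1
  rw [pquot, Int.le_floor, Int.cast_one]
  exact (one_le_div h0).2 h1.le

/-- The errors `q_n x - p_n` alternate in sign, consecutive ones have ratio `-gaussMap^[n] x`, and
the determinant of consecutive convergents is `±1`. -/
lemma exists_convergent_errors {x : ℝ} (hx : x ∈ Set.Ioo (0 : ℝ) 1) (hirr : Irrational x)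
    (n : ℕ) :
    ∃ s e : ℝ, |s| = 1 ∧ 0 < e ∧ 0 < qden x (n + 1) ∧ 0 ≤ qden x n ∧
      qden x n * x - pnum x n = -s * e ∧
      qden x (n + 1) * x - pnum x (n + 1) = s * (gaussMap^[n] x * e) ∧
      qden x (n + 1) * e + qden x n * (gaussMap^[n] x * e) = 1 := by
  induction n with
  | zero => exact ⟨1, 1, by simp [qden, pnum]⟩
  | succ n ih =>
    obtain ⟨s, e, hs, he, hq, hr, h0, h1, hdet⟩ := ih
    have ht := (gaussMap_iterate_mem_Ioo_and_irrational hx hirr n).1.1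
    have hstep := gaussMap_iterate_succ_mul hx hirr n
    have ha := one_le_pquot hx hirr n
    refine ⟨-s, gaussMap^[n] x * e, by rwa [abs_neg], by positivity, ?_, hq.le, ?_, ?_, ?_⟩
    · rw [qden]
      positivity
    · rw [h1]
      ring
    · rw [qden, pnum]
      push_cast
      linear_combination (pquot x n : ℝ) * h1 + h0 + s * e * hstep
    · rw [qden]
      push_cast
      linear_combination hdet + (qden x (n + 1) : ℝ) * e * hstep

/-- Consecutive Farey convergents: `1 < 2Θ(x, p_j/q_j) + Θ(x, f_j) < 2` for the final mediant
`f_j`, and consecutive mediants differ by less than `1` in approximation coefficient. -/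
theorem stmt_15 (x : ℝ) (hx : x ∈ Set.Ioo (0:ℝ) 1) (hirr : Irrational x) :
    (∀ j : ℕ,
      1 < 2 * Theta x (pnum x (j + 1)) (qden x (j + 1)) + medTheta x (pquot x j - 1) j ∧
      2 * Theta x (pnum x (j + 1)) (qden x (j + 1)) + medTheta x (pquot x j - 1) j < 2) ∧
    (∀ j : ℕ, 1 < pquot x j → ∀ l : ℕ, (l : ℤ) < pquot x j - 1 →
      |medTheta x ((l : ℤ) + 1) j - medTheta x (l : ℤ) j| < 1) := by
  have key (j : ℕ) : ∃ q r e t t' : ℝ, 0 < q ∧ 0 ≤ r ∧ 0 < e ∧ 0 < t ∧ 0 < t' ∧ t' < 1 ∧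
      t' * t = 1 - pquot x j * t ∧ q * e + r * (t * e) = 1 ∧
      Theta x (pnum x (j + 1)) (qden x (j + 1)) = q * (t * e) ∧
      ∀ l : ℤ, l ≤ pquot x j → medTheta x l j = (l * q + r) * (e - l * (t * e)) := by
    obtain ⟨s, e, hs, he, hq, hr, h0, h1, hdet⟩ := exists_convergent_errors hx hirr j
    have ht := (gaussMap_iterate_mem_Ioo_and_irrational hx hirr j).1.1
    have ht' := (gaussMap_iterate_mem_Ioo_and_irrational hx hirr (j + 1)).1
    have hstep := gaussMap_iterate_succ_mul hx hirr j
    refine ⟨qden x (j + 1), qden x j, e, gaussMap^[j] x, gaussMap^[j + 1] x, by exact_mod_cast hq,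
      by exact_mod_cast hr, he, ht, ht'.1, ht'.2, hstep, hdet, ?_, fun l hl => ?_⟩
    · rw [Theta, h1, abs_mul, hs, one_mul, abs_of_pos (by positivity)]
    · have herr : ((l * qden x (j + 1) + qden x j : ℤ) : ℝ) * x
          - ((l * pnum x (j + 1) + pnum x j : ℤ) : ℝ) = -s * (e - l * (gaussMap^[j] x * e)) := by
        push_cast
        linear_combination (l : ℝ) * h1 + h0
      have hnonneg : 0 ≤ e - l * (gaussMap^[j] x * e) := by
        have hl' : (l : ℝ) ≤ pquot x j := by exact_mod_cast hl
        have : 0 ≤ 1 - l * gaussMap^[j] x := by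
          nlinarith [mul_le_mul_of_nonneg_right hl' ht.le, mul_pos ht'.1 ht]
        nlinarith [mul_nonneg this he.le]
      rw [medTheta, Theta, herr, abs_mul, abs_neg, hs, one_mul, abs_of_nonneg hnonneg]
      push_cast
      ring
  refine ⟨fun j => ?_, fun j _ l hl => ?_⟩
  · obtain ⟨q, r, e, t, t', hq, hr, he, ht, ht0, ht1, hstep, hdet, hT, hM⟩ := key j
    have ha : (1 : ℝ) ≤ pquot x j := by exact_mod_cast one_le_pquot hx hirr j
    rw [hT, hM _ (by lia)]
    push_cast
    set b : ℝ := ((pquot x j : ℝ) - 1) * q + r with hb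
    have hb0 : 0 ≤ b := by
      have := mul_nonneg (sub_nonneg.2 ha) hq.le
      positivity
    have herr : e - ((pquot x j : ℝ) - 1) * (t * e) = (1 + t') * (t * e) := by
      linear_combination -e * hstep
    have hone : (b + q + q * t') * (t * e) = 1 := by
      linear_combination hdet + q * e * hstep
    have hte : 0 < t * e := by positivity
    rw [herr]
    constructor
    · have : 0 < (q * (1 - t') + b * t') * (t * e) :=
        mul_pos (by nlinarith [mul_pos hq (sub_pos.2 ht1), mul_nonneg hb0 ht0.le]) hte
      linarith
    · have : 0 < (b * (1 - t') + 2 * q * t') * (t * e) :=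
        mul_pos (by nlinarith [mul_nonneg hb0 (sub_pos.2 ht1).le, mul_pos hq ht0]) hte
      linarith
  · obtain ⟨q, r, e, t, t', hq, hr, he, ht, ht0, -, hstep, hdet, -, hM⟩ := key j
    have hM' := hM ((l : ℤ) + 1) (by lia)
    rw [hM', hM l (by lia)]
    push_cast
    have hl' : (l : ℝ) + 1 ≤ pquot x j := by exact_mod_cast (by lia : (l : ℤ) + 1 ≤ pquot x j)
    have hlt : 0 < 1 - ((l : ℝ) + 1) * t := by
      nlinarith [mul_le_mul_of_nonneg_right hl' ht.le, mul_pos ht0 ht]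
    have hqlt : 0 < q * e * (1 - ((l : ℝ) + 1) * t) := by positivity
    have hqte : 0 < q * (t * e) := by positivity
    have hrte : 0 ≤ r * (t * e) := by positivity
    have hlqte : 0 ≤ l * (q * (t * e)) := by positivity
    rw [abs_lt]
    constructor <;> nlinarith
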